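/- arXiv:1607.00700 — 3 statements merged into one kernel-verified Lean document; each statement's English description precedes it below -/
import Mathlib

section
/- Let p ≥ 5 be a prime and let α be a p-integer. Then C(αp−1, p−1) ≡ 1 − (1/3)·α(α−1)·p³·B_{p−3} (mod p⁴). -/
open Finset

/-- A rational number is a `p`-integer if its `p`-adic valuation is nonnegative
(equivalently, its denominator is not divisible by `p`). -/
def IsPInteger (p : ℕ) (x : ℚ) : Prop := 0 ≤ padicValRat p x

/-- `a ≡ b (mod p^m)` for `p`-integers: `(a - b) / p^m` is a `p`-integer. -/
def PModEq (p m : ℕ) (a b : ℚ) : Prop := IsPInteger p ((a - b) / (p : ℚ) ^ m)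

/-- The generalized binomial coefficient `C(αp - 1, p - 1) = (∏_{k=1}^{p-1} (αp - k)) / (p-1)!`. -/
def genBinom (p : ℕ) (α : ℚ) : ℚ :=
  (∏ k ∈ Finset.Icc 1 (p - 1), (α * p - k)) / (Nat.factorial (p - 1) : ℚ)

open Polynomial in
/-- The monic polynomial with roots `1, …, p - 1`. -/
noncomputable def rootsPoly (p : ℕ) : ℤ[X] :=
  ∏ k ∈ Finset.Icc 1 (p - 1), (X - C (k : ℤ))

/-- The elementary symmetric functions of `1, …, p - 1`. -/
def esymmIcc (p n : ℕ) : ℤ :=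
  ((Finset.univ : Finset (Fin (p - 1))).val.map fun i : Fin (p - 1) => ((i : ℕ) : ℤ) + 1).esymm n

lemma esymmIcc_zero (p : ℕ) : esymmIcc p 0 = 1 := by
  simp [esymmIcc, Multiset.esymm]

lemma rootsPoly_coeff (p : ℕ) {j : ℕ} (hj : j ≤ p - 1) :
    (rootsPoly p).coeff j = (-1) ^ (p - 1 - j) * esymmIcc p (p - 1 - j) := by
  set s := (Finset.univ : Finset (Fin (p - 1))).val.map fun i : Fin (p - 1) => ((i : ℕ) : ℤ) + 1 with hs
  have hcard : s.card = p - 1 := by simp [hs]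
  have hprod : rootsPoly p = (s.map fun t => Polynomial.X - Polynomial.C t).prod := by
    rw [hs, Multiset.map_map]
    change _ = ∏ i : Fin (p - 1), (Polynomial.X - Polynomial.C (((i : ℕ) : ℤ) + 1))
    rw [rootsPoly, ← Ico_add_one_right_eq_Icc, Finset.prod_Ico_eq_prod_range,
      Fin.prod_univ_eq_prod_range (fun i => Polynomial.X - Polynomial.C ((i : ℤ) + 1))]
    refine Finset.prod_congr (by simp) fun i _ => ?_
    simp [add_comm]
  rw [hprod, Multiset.prod_X_sub_C_coeff s (hcard ▸ hj), hcard, esymmIcc]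

lemma eval_eq_four_terms {R : Type*} [CommRing R] (F : Polynomial R) (x : R) :
    F.eval x = F.coeff 0 + F.coeff 1 * x + F.coeff 2 * x ^ 2 + F.coeff 3 * x ^ 3 +
      F.divX.divX.divX.divX.eval x * x ^ 4 := by
  have key (G : Polynomial R) : G.eval x = G.divX.eval x * x + G.coeff 0 := by
    conv_lhs => rw [← G.divX_mul_X_add]
    simp
  rw [key F, key F.divX, key F.divX.divX, key F.divX.divX.divX]
  simp only [Polynomial.coeff_divX]
  ring

lemma esymmIcc_newton (p n : ℕ) :
    (n : ℤ) * esymmIcc p n = (-1) ^ (n + 1) * ∑ a ∈ antidiagonal n with a.1 < n,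
      (-1) ^ a.1 * esymmIcc p a.1 * ∑ k ∈ range p, (k : ℤ) ^ a.2 := by
  have h := congrArg (MvPolynomial.aeval fun i : Fin (p - 1) => ((i : ℕ) : ℤ) + 1)
    (MvPolynomial.mul_esymm_eq_sum (Fin (p - 1)) ℤ n)
  simp only [map_mul, map_sum, map_pow, map_neg, map_one, map_natCast,
    MvPolynomial.aeval_esymm_eq_multiset_esymm, MvPolynomial.psum, MvPolynomial.aeval_X] at h
  rw [esymmIcc, h]
  congr 1
  refine Finset.sum_congr rfl fun a ha => ?_
  have ha2 : a.2 ≠ 0 := by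
    simp only [mem_filter, HasAntidiagonal.mem_antidiagonal] at ha
    omega
  rw [esymmIcc]
  congr 1
  rw [Fin.sum_univ_eq_sum_range (fun i => ((i : ℤ) + 1) ^ a.2)]
  cases p with
  | zero => simp
  | succ q => simp [sum_range_succ', ha2]

section PIntegers

variable (p : ℕ) [Fact p.Prime]

/-- The subring of `p`-integers in `ℚ`. -/
noncomputable def pIntegers : Subring ℚ := (PadicInt.subring p).comap (Rat.castHom ℚ_[p])

variable {p}

lemma mem_pIntegers_iff_norm {x : ℚ} : x ∈ pIntegers p ↔ ‖(x : ℚ_[p])‖ ≤ 1 := Iff.rfl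

lemma mem_pIntegers_iff {x : ℚ} : x ∈ pIntegers p ↔ IsPInteger p x := by
  rw [mem_pIntegers_iff_norm, Padic.norm_le_one_iff_val_nonneg, Padic.valuation_ratCast,
    IsPInteger]

lemma natCast_inv_mem_pIntegers {n : ℕ} (h : ¬ p ∣ n) : (n : ℚ)⁻¹ ∈ pIntegers p := by
  have h1 : ‖(n : ℚ_[p])‖ = 1 :=
    Padic.norm_natCast_eq_one_iff.2 ((Nat.Prime.coprime_iff_not_dvd Fact.out).2 h)
  simp [mem_pIntegers_iff_norm, h1]

lemma natCast_inv_mem_pIntegers_of_lt {n : ℕ} (h0 : 0 < n) (h : n < p) :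
    (n : ℚ)⁻¹ ∈ pIntegers p :=
  natCast_inv_mem_pIntegers (Nat.not_dvd_of_pos_of_lt h0 h)

lemma bernoulli_mem_pIntegers {n : ℕ} (hn : n + 1 < p) : bernoulli n ∈ pIntegers p := by
  induction n using Nat.strong_induction_on with
  | _ n ih =>
    have h := sum_bernoulli (n + 1)
    rw [sum_range_succ] at h
    have hne : ((n + 1 : ℕ) : ℚ) ≠ 0 := by positivity
    have h' : bernoulli n = ((if n + 1 = 1 then 1 else 0) -
        ∑ k ∈ range n, ((n + 1).choose k : ℚ) * bernoulli k) * ((n + 1 : ℕ) : ℚ)⁻¹ := by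
      rw [← h, eq_mul_inv_iff_mul_eq₀ hne, Nat.choose_succ_self_right]
      ring
    rw [h']
    refine mul_mem (sub_mem ?_ (sum_mem fun k hk => ?_))
      (natCast_inv_mem_pIntegers_of_lt n.succ_pos hn)
    · split_ifs
      exacts [one_mem _, zero_mem _]
    · have hk := mem_range.1 hk
      exact mul_mem (natCast_mem _ _) (ih k hk (by omega))

lemma sum_range_pow_eq_mul_bernoulli_add {n : ℕ} (hn : n + 1 < p) :
    ∃ r ∈ pIntegers p, ∑ k ∈ range p, (k : ℚ) ^ n = p * bernoulli n + p ^ 2 * r := by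
  have hinv := natCast_inv_mem_pIntegers_of_lt n.succ_pos hn
  refine ⟨∑ i ∈ range n, bernoulli i * ((n + 1).choose i) * (p : ℚ) ^ (n - 1 - i) *
    ((n + 1 : ℕ) : ℚ)⁻¹, sum_mem fun i hi => ?_, ?_⟩
  · have hi := mem_range.1 hi
    exact mul_mem (mul_mem (mul_mem (bernoulli_mem_pIntegers (by omega)) (natCast_mem _ _))
      (pow_mem (natCast_mem _ _) _)) hinv
  · rw [sum_range_pow, sum_range_succ, add_comm, mul_sum]
    have hne : (n : ℚ) + 1 ≠ 0 := by positivity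
    congr 1
    · rw [Nat.choose_succ_self_right, Nat.add_sub_cancel_left]
      push_cast
      field_simp
    · refine sum_congr rfl fun i hi => ?_
      have hi := mem_range.1 hi
      rw [show n + 1 - i = n - 1 - i + 2 by omega, pow_add]
      push_cast
      field_simp

lemma mul_esymmIcc_eq {n : ℕ} (h0 : 0 < n) (hn : n + 1 < p) :
    ∃ r ∈ pIntegers p,
      (n : ℚ) * esymmIcc p n = (-1) ^ (n + 1) * (p * bernoulli n) + p ^ 2 * r := by
  induction n using Nat.strong_induction_on with
  | _ n ih =>
    have hterm : ∀ a ∈ (antidiagonal n).filter (fun a => a.1 < n), ∃ r ∈ pIntegers p,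
        (-1) ^ a.1 * (esymmIcc p a.1 : ℚ) * ∑ k ∈ range p, (k : ℚ) ^ a.2 =
          (if a = (0, n) then p * bernoulli n else 0) + p ^ 2 * r := by
      rintro ⟨i, j⟩ ha
      simp only [mem_filter, HasAntidiagonal.mem_antidiagonal] at ha
      obtain ⟨s, hs, hsum⟩ := sum_range_pow_eq_mul_bernoulli_add (p := p) (n := j) (by omega)
      rcases Nat.eq_zero_or_pos i with rfl | hi
      · obtain rfl : j = n := by omega
        exact ⟨s, hs, by simp [hsum, esymmIcc_zero]⟩
      · obtain ⟨r, hr, hri⟩ := ih i (by omega) hi (by omega)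
        have hB := bernoulli_mem_pIntegers (p := p) (n := i) (by omega)
        have hB' := bernoulli_mem_pIntegers (p := p) (n := j) (by omega)
        have hinv := natCast_inv_mem_pIntegers_of_lt (p := p) hi (by omega)
        have hp := natCast_mem (pIntegers p) p
        have hneg (m : ℕ) : (-1 : ℚ) ^ m ∈ pIntegers p := pow_mem (neg_mem (one_mem _)) m
        refine ⟨(-1) ^ i * ((i : ℚ)⁻¹ * ((-1) ^ (i + 1) * bernoulli i + p * r)) *
          (bernoulli j + p * s), ?_, ?_⟩
        · exact mul_mem (mul_mem (hneg _) (mul_mem hinv (add_mem (mul_mem (hneg _) hB)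
            (mul_mem hp hr)))) (add_mem hB' (mul_mem hp hs))
        · have hne : (i : ℚ) ≠ 0 := by positivity
          have he : (esymmIcc p i : ℚ) =
              (i : ℚ)⁻¹ * ((-1) ^ (i + 1) * (p * bernoulli i) + p ^ 2 * r) := by
            rw [← hri]
            field_simp
          have hne' : ((i, j) : ℕ × ℕ) ≠ (0, n) := by
            simp [hi.ne']
          rw [if_neg hne', he, hsum]
          ring
    choose! r hr hre using hterm
    refine ⟨(-1) ^ (n + 1) * ∑ a ∈ antidiagonal n with a.1 < n, r a,
      mul_mem (pow_mem (neg_mem (one_mem _)) _) (sum_mem hr), ?_⟩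
    have h := congrArg (Int.cast : ℤ → ℚ) (esymmIcc_newton p n)
    push_cast at h
    rw [h, sum_congr rfl hre, sum_add_distrib, ← mul_sum, sum_ite_eq_of_mem' _ _ _ (by simp [h0])]
    ring

lemma esymmIcc_eq_mul {n : ℕ} (h0 : 0 < n) (hn : n + 1 < p) :
    ∃ r ∈ pIntegers p, (esymmIcc p n : ℚ) = p * r := by
  obtain ⟨r, hr, h⟩ := mul_esymmIcc_eq h0 hn
  have hne : (n : ℚ) ≠ 0 := by positivity
  refine ⟨(n : ℚ)⁻¹ * ((-1) ^ (n + 1) * bernoulli n + p * r), ?_, ?_⟩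
  · exact mul_mem (natCast_inv_mem_pIntegers_of_lt h0 (by omega))
      (add_mem (mul_mem (pow_mem (neg_mem (one_mem _)) _) (bernoulli_mem_pIntegers hn))
        (mul_mem (natCast_mem _ _) hr))
  · field_simp
    linear_combination h

lemma rootsPoly_coeff_two (hp5 : 5 ≤ p) :
    ∃ s ∈ pIntegers p,
      ((rootsPoly p).coeff 2 : ℚ) = p * (3⁻¹ * bernoulli (p - 3)) + p ^ 2 * s := by
  obtain ⟨m, hm⟩ := (Fact.out : p.Prime).odd_of_ne_two (by omega)
  have hcoeff : (rootsPoly p).coeff 2 = esymmIcc p (p - 3) := by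
    rw [rootsPoly_coeff p (by omega), show p - 1 - 2 = p - 3 by omega,
      Even.neg_one_pow ⟨m - 1, by omega⟩, one_mul]
  obtain ⟨r, hr, h⟩ := mul_esymmIcc_eq (p := p) (n := p - 3) (by omega) (by omega)
  obtain ⟨d, hd, h'⟩ := esymmIcc_eq_mul (p := p) (n := p - 3) (by omega) (by omega)
  rw [Odd.neg_one_pow ⟨m - 1, by omega⟩, Nat.cast_sub (by omega)] at h
  refine ⟨((3 : ℕ) : ℚ)⁻¹ * (d - r), mul_mem
    (natCast_inv_mem_pIntegers_of_lt (by omega) (by omega)) (sub_mem hd hr), ?_⟩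
  rw [hcoeff]
  push_cast at h ⊢
  linear_combination (-1 / 3) * h + p / 3 * h'

lemma rootsPoly_coeff_three (hp5 : 5 ≤ p) :
    ∃ d ∈ pIntegers p, ((rootsPoly p).coeff 3 : ℚ) = p * d := by
  obtain ⟨d, hd, h⟩ := esymmIcc_eq_mul (p := p) (n := p - 4) (by omega) (by omega)
  refine ⟨(-1) ^ (p - 4) * d, mul_mem (pow_mem (neg_mem (one_mem _)) _) hd, ?_⟩
  rw [rootsPoly_coeff p (by omega), show p - 1 - 3 = p - 4 by omega]
  push_cast
  rw [h]
  ring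

lemma eval_map_mem_pIntegers (F : Polynomial ℤ) {x : ℚ} (hx : x ∈ pIntegers p) :
    (F.map (Int.castRingHom ℚ)).eval x ∈ pIntegers p := by
  rw [Polynomial.eval_eq_sum_range]
  refine sum_mem fun i _ => mul_mem ?_ (pow_mem hx i)
  rw [Polynomial.coeff_map]
  exact intCast_mem _ _

lemma rootsPoly_eval_mul {α : ℚ} (hα : α ∈ pIntegers p) :
    ∃ G ∈ pIntegers p, ∏ k ∈ Finset.Icc 1 (p - 1), (α * p - k) =
      (rootsPoly p).coeff 0 + (rootsPoly p).coeff 1 * (α * p) +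
      (rootsPoly p).coeff 2 * (α * p) ^ 2 + (rootsPoly p).coeff 3 * (α * p) ^ 3 + p ^ 4 * G := by
  have hx := mul_mem hα (natCast_mem (pIntegers p) p)
  refine ⟨α ^ 4 * ((rootsPoly p).divX.divX.divX.divX.map (Int.castRingHom ℚ)).eval (α * p),
    mul_mem (pow_mem hα 4) (eval_map_mem_pIntegers _ hx), ?_⟩
  have h := eval_eq_four_terms ((rootsPoly p).map (Int.castRingHom ℚ)) (α * p)
  have hdiv (F : Polynomial ℤ) :
      (F.map (Int.castRingHom ℚ)).divX = F.divX.map (Int.castRingHom ℚ) := by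
    ext
    simp [Polynomial.coeff_divX]
  simp only [hdiv, Polynomial.coeff_map, eq_intCast] at h
  have hprod : ((rootsPoly p).map (Int.castRingHom ℚ)).eval (α * p) =
      ∏ k ∈ Finset.Icc 1 (p - 1), (α * p - k) := by
    simp [rootsPoly, Polynomial.map_prod, Polynomial.eval_prod]
  rw [← hprod, h]
  ring

end PIntegers

theorem genBinom_bernoulli_mod_p4 (p : ℕ) (hp : p.Prime) (hp5 : 5 ≤ p)
    (α : ℚ) (hα : IsPInteger p α) :
    PModEq p 4 (genBinom p α)
      (1 - (1 / 3) * α * (α - 1) * p ^ 3 * bernoulli (p - 3)) := by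
  have : Fact p.Prime := ⟨hp⟩
  rw [← mem_pIntegers_iff] at hα
  rw [PModEq, ← mem_pIntegers_iff, genBinom]
  have hpne : (p : ℚ) ≠ 0 := by exact_mod_cast hp.ne_zero
  have hfact : ∏ k ∈ Finset.Icc 1 (p - 1), k = (p - 1).factorial := by
    rw [← Ico_add_one_right_eq_Icc, Finset.prod_Ico_id_eq_factorial]
  have hc0 : ((rootsPoly p).coeff 0 : ℚ) = (p - 1).factorial := by
    have heven : Even (p - 1) := hp.even_sub_one (by omega)
    rw [Polynomial.coeff_zero_eq_eval_zero, rootsPoly, Polynomial.eval_prod, ← hfact]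
    simp [Finset.prod_neg, heven.neg_one_pow]
  have hprod1 : ∏ k ∈ Finset.Icc 1 (p - 1), ((1 : ℚ) * p - k) = (p - 1).factorial := by
    rw [← hfact, Nat.cast_prod]
    refine Finset.prod_nbij' (fun k => p - k) (fun k => p - k) ?_ ?_ ?_ ?_ ?_ <;>
      intro k hk <;> have hk := Finset.mem_Icc.1 hk
    · exact Finset.mem_Icc.2 (by omega)
    · exact Finset.mem_Icc.2 (by omega)
    · omega
    · omega
    · rw [one_mul, Nat.cast_sub (by omega)]
  obtain ⟨G, hG, hQ⟩ := rootsPoly_eval_mul hα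
  obtain ⟨G₁, hG₁, hQ₁⟩ := rootsPoly_eval_mul (one_mem (pIntegers p))
  obtain ⟨s, hs, hc2⟩ := rootsPoly_coeff_two hp5
  obtain ⟨d, hd, hc3⟩ := rootsPoly_coeff_three hp5
  obtain ⟨w, hw⟩ : (p : ℤ) ∣ ((p - 1).factorial : ℤ) + 1 := by
    rw [← ZMod.intCast_zmod_eq_zero_iff_dvd]
    simp [ZMod.wilsons_lemma]
  have hw' : ((p - 1).factorial : ℚ) + 1 = p * w := by exact_mod_cast hw
  have hB := bernoulli_mem_pIntegers (p := p) (n := p - 3) (by omega)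
  have h3 : (3 : ℚ)⁻¹ ∈ pIntegers p := by
    exact_mod_cast natCast_inv_mem_pIntegers_of_lt (p := p) (n := 3) (by omega) (by omega)
  have hf : ((p - 1).factorial : ℚ)⁻¹ ∈ pIntegers p :=
    natCast_inv_mem_pIntegers (by rw [hp.dvd_factorial]; omega)
  have hfne : ((p - 1).factorial : ℚ) ≠ 0 := by positivity
  have hα1 := sub_mem hα (one_mem (pIntegers p))
  rw [hprod1, hc0, hc2, hc3] at hQ₁
  rw [hc0, hc2, hc3] at hQ
  have heq : ((∏ k ∈ Finset.Icc 1 (p - 1), (α * p - k)) / ((p - 1).factorial : ℚ) -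
      (1 - (1 / 3) * α * (α - 1) * p ^ 3 * bernoulli (p - 3))) / (p : ℚ) ^ 4 =
      (α * (α - 1) * s - α * (d + G₁) + d * α ^ 3 + G +
        w * (α * (α - 1)) * (3⁻¹ * bernoulli (p - 3))) * ((p - 1).factorial : ℚ)⁻¹ := by
    rw [hQ]
    field_simp
    linear_combination (-3 * α) * hQ₁ + α * (α - 1) * p ^ 3 * bernoulli (p - 3) * hw'
  rw [heq]
  refine mul_mem (add_mem (add_mem (add_mem (sub_mem ?_ ?_) ?_) hG) ?_) hf
  · exact mul_mem (mul_mem hα hα1) hs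
  · exact mul_mem hα (add_mem hd hG₁)
  · exact mul_mem hd (pow_mem hα 3)
  · exact mul_mem (mul_mem (intCast_mem _ _) (mul_mem hα hα1)) (mul_mem h3 hB)
end

section
/- Let p ≥ 7 be a prime and let α be a p-integer. Then C(αp−1, p−1) ≡ 1 + α(α−1)·p·(∑_{k=1}^{p−1} 1/k) (mod p⁵). -/
open Finset

/-- Pairing the factor at `k` with the factor at `2 * m + 1 - k`. -/
@[to_additive]
lemma prod_Icc_even_fold {M : Type*} [CommMonoid M] (f : ℕ → M) (m : ℕ) :
    ∏ k ∈ Icc 1 (2 * m), f k = ∏ k ∈ Icc 1 m, f k * f (2 * m + 1 - k) := by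
  have hIcc (n : ℕ) (g : ℕ → M) : ∏ k ∈ Icc 1 n, g k = ∏ k ∈ range n, g (k + 1) := by
    rw [← Finset.Ico_add_one_right_eq_Icc, prod_Ico_eq_prod_range]
    simp [add_comm]
  rw [hIcc, hIcc, prod_mul_distrib, two_mul, prod_range_add]
  congr 1
  refine prod_nbij' (fun k => m - 1 - k) (fun k => m - 1 - k) ?_ ?_ ?_ ?_ ?_ <;>
    intro k hk <;> rw [mem_range] at hk
  · rw [mem_range]
    lia
  · rw [mem_range]
    lia
  · lia
  · lia
  · congr 1
    lia

/-- Second-order expansion of `∏ (1 + t * u k)`, the second-order coefficient being given by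
Newton's identity. -/
lemma exists_prod_one_add_mul_eq {R ι : Type*} [CommRing R] (s : Finset ι) (u : ι → R) (t : R) :
    ∃ E Z : R, 2 * E = (∑ k ∈ s, u k) ^ 2 - ∑ k ∈ s, u k ^ 2 ∧
      ∏ k ∈ s, (1 + t * u k) = 1 + t * ∑ k ∈ s, u k + t ^ 2 * E + t ^ 3 * Z := by
  classical
  induction s using Finset.induction_on with
  | empty => exact ⟨0, 0, by simp, by simp⟩
  | insert a s ha ih =>
    obtain ⟨E, Z, hE, hZ⟩ := ih
    refine ⟨E + u a * ∑ k ∈ s, u k, Z + u a * E + t * u a * Z, ?_, ?_⟩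
    · rw [sum_insert ha, sum_insert ha]
      linear_combination hE
    · rw [prod_insert ha, sum_insert ha, hZ]
      ring

section ZModSums

variable {p : ℕ} [Fact p.Prime]

lemma zmod_two_ne_zero (hp : 2 < p) : (2 : ZMod p) ≠ 0 := by
  exact_mod_cast (ZMod.natCast_eq_zero_iff 2 p).not.mpr (Nat.not_dvd_of_pos_of_lt two_pos hp)

lemma sum_Icc_natCast_inv_pow_eq_zero {i : ℕ} (hi0 : i ≠ 0) (hi : i < p - 1) :
    ∑ k ∈ Icc 1 (p - 1), ((k : ZMod p)⁻¹) ^ i = 0 := by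
  have hsum : ∑ x : ZMod p, x⁻¹ ^ i = 0 := by
    refine (Equiv.sum_comp ((inv_involutive (G := ZMod p)).toPerm) (fun x => x ^ i)).trans ?_
    exact FiniteField.sum_pow_lt_card_sub_one (ZMod p) i (by rwa [ZMod.card])
  rw [← hsum, ← sum_erase univ (a := (0 : ZMod p)) (by simp [hi0])]
  refine sum_nbij' (fun k => (k : ZMod p)) ZMod.val ?_ ?_ ?_ ?_ ?_
  · intro k hk
    rw [mem_Icc] at hk
    simp only [mem_erase, mem_univ, and_true, ne_eq, ZMod.natCast_eq_zero_iff]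
    exact Nat.not_dvd_of_pos_of_lt (by lia) (by lia)
  · intro x hx
    have h0 : x.val ≠ 0 := by simpa using hx
    have := ZMod.val_lt x
    rw [mem_Icc]
    lia
  · intro k hk
    rw [mem_Icc] at hk
    exact ZMod.val_cast_of_lt (by lia)
  · intro x _
    exact ZMod.natCast_zmod_val x
  · intro k _
    rfl

lemma sum_Icc_half_natCast_inv_pow_eq_zero {m i : ℕ} (hm : p = 2 * m + 1) (hi0 : i ≠ 0)
    (hie : Even i) (hi : i < p - 1) :
    ∑ k ∈ Icc 1 m, ((k : ZMod p)⁻¹) ^ i = 0 := by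
  have h := sum_Icc_natCast_inv_pow_eq_zero hi0 hi
  rw [show p - 1 = 2 * m by lia, sum_Icc_even_fold] at h
  refine (mul_eq_zero.mp (?_ : (2 : ZMod p) * _ = 0)).resolve_left (zmod_two_ne_zero (by lia))
  rw [← h, mul_sum]
  refine sum_congr rfl fun k hk => ?_
  rw [mem_Icc] at hk
  rw [← hm, Nat.cast_sub (by lia), ZMod.natCast_self, zero_sub, inv_neg, hie.neg_pow, two_mul]

end ZModSums

lemma isPInteger_iff_norm_le_one {p : ℕ} [Fact p.Prime] (x : ℚ) :
    IsPInteger p x ↔ ‖(x : ℚ_[p])‖ ≤ 1 := by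
  have h1 : (1 : ℝ) < p := mod_cast (Fact.out : p.Prime).one_lt
  rw [IsPInteger, Padic.eq_padicNorm]
  rcases eq_or_ne x 0 with rfl | hx
  · simp
  · rw [padicNorm.eq_zpow_of_nonzero hx]
    push_cast
    rw [zpow_le_one_iff_right₀ h1]
    lia

lemma genBinom_eq_prod {p m : ℕ} (hm : p = 2 * m + 1) (α : ℚ) :
    genBinom p α = ∏ k ∈ Icc 1 m, (1 + α * (α - 1) * p ^ 2 * ((k : ℚ) * (p - k))⁻¹) := by
  rw [genBinom, ← prod_Ico_id_eq_factorial, Finset.Ico_add_one_right_eq_Icc, Nat.cast_prod, ← prod_div_distrib,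
    show p - 1 = 2 * m by lia, prod_Icc_even_fold]
  refine prod_congr rfl fun k hk => ?_
  rw [mem_Icc] at hk
  have hk0 : (k : ℚ) ≠ 0 := by
    have : k ≠ 0 := by lia
    exact_mod_cast this
  have hpk : (p : ℚ) - k ≠ 0 := by
    rw [sub_ne_zero]
    have : p ≠ k := by lia
    exact_mod_cast this
  rw [← hm, Nat.cast_sub (by lia)]
  field_simp
  ring

lemma sum_Icc_one_div_eq {p m : ℕ} (hm : p = 2 * m + 1) :
    ∑ k ∈ Icc 1 (p - 1), (1 : ℚ) / k = p * ∑ k ∈ Icc 1 m, ((k : ℚ) * (p - k))⁻¹ := by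
  rw [show p - 1 = 2 * m by lia, sum_Icc_even_fold, mul_sum]
  refine sum_congr rfl fun k hk => ?_
  rw [mem_Icc] at hk
  have hk0 : (k : ℚ) ≠ 0 := by
    have : k ≠ 0 := by lia
    exact_mod_cast this
  have hpk : (p : ℚ) - k ≠ 0 := by
    rw [sub_ne_zero]
    have : p ≠ k := by lia
    exact_mod_cast this
  rw [← hm, Nat.cast_sub (by lia)]
  field_simp
  ring

theorem genBinom_harmonic_mod_p5 (p : ℕ) (hp : p.Prime) (hp7 : 7 ≤ p)
    (α : ℚ) (hα : IsPInteger p α) :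
    PModEq p 5 (genBinom p α)
      (1 + α * (α - 1) * p * (∑ k ∈ Finset.Icc 1 (p - 1), (1 : ℚ) / k)) := by
  have : Fact p.Prime := ⟨hp⟩
  obtain ⟨m, hm⟩ := hp.odd_of_ne_two (by lia)
  obtain ⟨a, ha⟩ : ∃ a : ℤ_[p], (a : ℚ_[p]) = α :=
    ⟨⟨α, (isPInteger_iff_norm_le_one α).mp hα⟩, rfl⟩
  have hunit (k : ℕ) (hk : k ∈ Icc 1 m) : ∃ u : ℤ_[p], (k : ℤ_[p]) * (p - k) * u = 1 := by
    rw [mem_Icc] at hk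
    rw [← isUnit_iff_exists_inv, ← Nat.cast_sub (by lia), ← Nat.cast_mul,
      PadicInt.isUnit_iff, PadicInt.norm_natCast_eq_one_iff]
    exact (Nat.coprime_of_lt_prime (by lia) (by lia) hp).mul_right
      (Nat.coprime_of_lt_prime (by lia) (by lia) hp)
  choose! u hu using hunit
  have hu_coe (k : ℕ) (hk : k ∈ Icc 1 m) : (u k : ℚ_[p]) = ((k : ℚ_[p]) * (p - k))⁻¹ := by
    refine eq_inv_of_mul_eq_one_right ?_
    exact_mod_cast congrArg (fun x : ℤ_[p] => (x : ℚ_[p])) (hu k hk)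
  have hu_mod (k : ℕ) (hk : k ∈ Icc 1 m) : PadicInt.toZMod (u k) = -((k : ZMod p)⁻¹) ^ 2 := by
    have h := congrArg PadicInt.toZMod (hu k hk)
    simp only [map_mul, map_sub, map_natCast, map_one, CharP.cast_eq_zero, zero_sub] at h
    rw [eq_inv_of_mul_eq_one_right h, mul_neg, inv_neg, ← sq, inv_pow]
  obtain ⟨E, Z, hE, hprod⟩ := exists_prod_one_add_mul_eq (Icc 1 m) u (a * (a - 1) * p ^ 2)
  obtain ⟨F, rfl⟩ : (p : ℤ_[p]) ∣ E := by
    rw [← Ideal.mem_span_singleton, ← PadicInt.maximalIdeal_eq_span_p, ← PadicInt.ker_toZMod,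
      RingHom.mem_ker]
    have h := congrArg PadicInt.toZMod hE
    have hsum : ∑ k ∈ Icc 1 m, PadicInt.toZMod (u k) = 0 := by
      rw [sum_congr rfl hu_mod, sum_neg_distrib,
        sum_Icc_half_natCast_inv_pow_eq_zero hm two_ne_zero even_two (by lia), neg_zero]
    have hsum_sq : ∑ k ∈ Icc 1 m, PadicInt.toZMod (u k) ^ 2 = 0 := by
      rw [sum_congr rfl fun k hk => by rw [hu_mod k hk, neg_sq, ← pow_mul]]
      exact sum_Icc_half_natCast_inv_pow_eq_zero hm (by lia) (by decide) (by lia)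
    simp only [map_mul, map_sub, map_pow, map_sum, hsum, hsum_sq, map_ofNat] at h
    exact (mul_eq_zero.mp (h.trans (by simp))).resolve_left (zmod_two_ne_zero (by lia))
  have hp0 : (p : ℚ_[p]) ≠ 0 := mod_cast hp.ne_zero
  have hsum_coe : ((∑ k ∈ Icc 1 m, u k : ℤ_[p]) : ℚ_[p]) =
      ∑ k ∈ Icc 1 m, ((k : ℚ_[p]) * (p - k))⁻¹ := by
    rw [PadicInt.coe_sum, sum_congr rfl hu_coe]
  have hprod_coe : ((∏ k ∈ Icc 1 m, (1 + a * (a - 1) * p ^ 2 * u k) : ℤ_[p]) : ℚ_[p]) =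
      ∏ k ∈ Icc 1 m, (1 + (α : ℚ_[p]) * (α - 1) * p ^ 2 * ((k : ℚ_[p]) * (p - k))⁻¹) := by
    refine (map_prod PadicInt.Coe.ringHom _ _).trans ?_
    refine prod_congr rfl fun k hk => ?_
    change ((1 + a * (a - 1) * p ^ 2 * u k : ℤ_[p]) : ℚ_[p]) = _
    push_cast
    rw [hu_coe k hk, ha]
  rw [PModEq, isPInteger_iff_norm_le_one, genBinom_eq_prod hm, sum_Icc_one_div_eq hm]
  push_cast
  rw [← hprod_coe, ← hsum_coe, hprod, ← ha]
  convert PadicInt.norm_le_one ((a * (a - 1)) ^ 2 * F + (a * (a - 1)) ^ 3 * (p : ℤ_[p]) * Z) using 2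
  rw [PadicInt.norm_def]
  congr 1
  push_cast
  field_simp
  ring
end

section
/- Let p ≥ 7 be a prime. Then (−1)^{(p−1)/2}·C(p−1, (p−1)/2) ≡ 4^{p−1}·(1 + (1/8)·p²·(∑_{k=1}^{p−1} 1/k²)) (mod p⁵), where C(p−1, (p−1)/2) denotes the central binomial coefficient. -/
open Finset

/-- Second-order expansion of `∏ (1 + x c_j)`, doubled to avoid halving the second
elementary symmetric function. -/
lemma exists_two_mul_prod_one_add_mul {R ι : Type*} [CommRing R] (s : Finset ι) (c : ι → R)
    (x : R) : ∃ r, 2 * ∏ j ∈ s, (1 + x * c j) =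
      2 + 2 * x * ∑ j ∈ s, c j + x ^ 2 * ((∑ j ∈ s, c j) ^ 2 - ∑ j ∈ s, c j ^ 2) + x ^ 3 * r := by
  classical
  induction s using Finset.induction_on with
  | empty => exact ⟨0, by simp⟩
  | insert a s ha ih =>
    obtain ⟨r, hr⟩ := ih
    refine ⟨r + c a * ((∑ j ∈ s, c j) ^ 2 - ∑ j ∈ s, c j ^ 2) + x * c a * r, ?_⟩
    rw [Finset.prod_insert ha, Finset.sum_insert ha, Finset.sum_insert ha]
    linear_combination (1 + x * c a) * hr

lemma prod_range_odd_mul (n : ℕ) :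
    (∏ j ∈ range n, (2 * j + 1)) * (2 ^ n * n.factorial) = (2 * n).factorial := by
  induction n with
  | zero => simp
  | succ n ih =>
    rw [Finset.prod_range_succ, show 2 * (n + 1) = 2 * n + 1 + 1 by ring, Nat.factorial_succ,
      Nat.factorial_succ, Nat.factorial_succ, ← ih]
    ring

lemma prod_Icc_one_sub {M : Type*} [CommMonoid M] (n : ℕ) (f : ℕ → M) :
    ∏ j ∈ Icc 1 n, f (n - j) = ∏ j ∈ range n, f j := by
  refine prod_nbij' (fun j => n - j) (fun j => n - j) ?_ ?_ ?_ ?_ fun _ _ => rfl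
  all_goals intro j hj; simp only [mem_range, mem_Icc] at *; omega

lemma prod_Icc_odd (n : ℕ) :
    ∏ j ∈ Icc 1 n, (2 * n + 1 - 2 * j : ℚ) = ((∏ j ∈ range n, (2 * j + 1) : ℕ) : ℚ) := by
  rw [← prod_Icc_one_sub, Nat.cast_prod]
  refine prod_congr rfl fun j hj => ?_
  push_cast [(mem_Icc.1 hj).2]
  ring

lemma prod_Icc_sub (n : ℕ) :
    (∏ j ∈ Icc 1 n, (2 * n + 1 - j : ℚ)) * n.factorial = (2 * n).factorial := by
  have h : ∏ j ∈ Icc 1 n, (2 * n + 1 - j : ℚ) = ((n + 1).ascFactorial n : ℕ) := by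
    rw [Nat.ascFactorial_eq_prod_range, ← prod_Icc_one_sub, Nat.cast_prod]
    refine prod_congr rfl fun j hj => ?_
    push_cast [(mem_Icc.1 hj).2]
    ring
  rw [h, mul_comm, two_mul]
  exact_mod_cast Nat.factorial_mul_ascFactorial n n

lemma neg_one_pow_mul_centralBinom (n : ℕ) :
    (-1 : ℚ) ^ n * ((2 * n).choose n : ℚ) =
      16 ^ n * ∏ j ∈ Icc 1 n, (1 - (2 * n + 1) ^ 2 / (4 * (j * (2 * n + 1 - j))) : ℚ) := by
  have hterm : ∀ j ∈ Icc 1 n, (1 - (2 * n + 1) ^ 2 / (4 * (j * (2 * n + 1 - j))) : ℚ) =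
      (-1) * (2 * n + 1 - 2 * j) ^ 2 / (4 * (j * (2 * n + 1 - j))) := by
    intro j hj
    rw [mem_Icc] at hj
    have h1 : (0 : ℚ) < j := by exact_mod_cast hj.1
    have h2 : (j : ℚ) ≤ n := by exact_mod_cast hj.2
    have h3 : (2 * n + 1 - j : ℚ) ≠ 0 := by linarith
    field_simp
    ring
  rw [prod_congr rfl hterm]
  simp only [prod_div_distrib, prod_mul_distrib, prod_const, Nat.card_Icc, prod_pow,
    Nat.add_sub_cancel]
  have hfac : ∏ j ∈ Icc 1 n, (j : ℚ) = n.factorial := by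
    rw [← prod_Ico_id_eq_factorial, Ico_add_one_right_eq_Icc, Nat.cast_prod]
  have hodd : ((∏ j ∈ range n, (2 * j + 1) : ℕ) : ℚ) * (2 ^ n * n.factorial) =
      (2 * n).factorial := by exact_mod_cast prod_range_odd_mul n
  have hch : ((2 * n).choose n : ℚ) * n.factorial * n.factorial = (2 * n).factorial := by
    have := Nat.choose_mul_factorial_mul_factorial (show n ≤ 2 * n by omega)
    rw [show 2 * n - n = n by omega] at this
    exact_mod_cast this
  have hsub := prod_Icc_sub n
  rw [hfac, prod_Icc_odd]
  have hn : (n.factorial : ℚ) ≠ 0 := by positivity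
  have h2n : ((2 * n).factorial : ℚ) ≠ 0 := by positivity
  have hP : ∏ j ∈ Icc 1 n, (2 * n + 1 - j : ℚ) ≠ 0 := by
    intro h
    rw [h, zero_mul] at hsub
    exact h2n hsub.symm
  generalize ((∏ j ∈ range n, (2 * j + 1) : ℕ) : ℚ) = O at *
  generalize ∏ j ∈ Icc 1 n, (2 * n + 1 - j : ℚ) = P at *
  generalize ((2 * n).choose n : ℚ) = C at *
  have hO : O = (2 * n).factorial / (2 ^ n * n.factorial) := by
    field_simp; linarith
  have hC : C = (2 * n).factorial / (n.factorial * n.factorial) := by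
    field_simp; linarith
  have hP' : P = (2 * n).factorial / n.factorial := by
    field_simp; linarith
  subst hO hC hP'
  have e16 : (16 : ℚ) ^ n = (2 ^ n) ^ 4 := by rw [← pow_mul, mul_comm, pow_mul]; norm_num
  have e4 : (4 : ℚ) ^ n = (2 ^ n) ^ 2 := by rw [← pow_mul, mul_comm, pow_mul]; norm_num
  rw [e16, e4]
  field_simp

lemma sum_Icc_one_two_mul {M : Type*} [AddCommMonoid M] (n : ℕ) (f : ℕ → M) :
    ∑ j ∈ Icc 1 (2 * n), f j = ∑ j ∈ Icc 1 n, (f j + f (2 * n + 1 - j)) := by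
  rw [sum_add_distrib, ← Finset.sum_filter_add_sum_filter_not (Icc 1 (2 * n)) (· ≤ n)]
  congr 1
  · apply sum_congr _ fun _ _ => rfl
    ext j; simp only [mem_filter, mem_Icc]; omega
  · refine sum_nbij' (fun j => 2 * n + 1 - j) (fun j => 2 * n + 1 - j) ?_ ?_ ?_ ?_ ?_
    all_goals intro j hj; simp only [mem_filter, mem_Icc] at *
    all_goals first | omega | (congr 1; omega)

lemma ZMod.sum_Icc_inv_pow_eq_zero (p : ℕ) [Fact p.Prime] (k : ℕ) (hk0 : k ≠ 0)
    (hk : k < p - 1) : ∑ j ∈ Icc 1 (p - 1), ((j : ZMod p)⁻¹) ^ k = 0 := by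
  have hp := (Fact.out : p.Prime).pos
  have h1 : ∑ x : ZMod p, x⁻¹ ^ k = 0 := by
    refine (Equiv.sum_comp (Equiv.inv (ZMod p)) (fun x => x ^ k)).trans ?_
    exact FiniteField.sum_pow_lt_card_sub_one _ k (by rwa [ZMod.card])
  have h2 : ∑ j ∈ range p, ((j : ZMod p)⁻¹) ^ k = 0 := by
    rw [← h1]
    refine sum_nbij' (fun j => (j : ZMod p)) ZMod.val ?_ ?_ ?_ ?_ ?_
    · simp
    · intro x _; simpa using ZMod.val_lt x
    · intro j hj; exact ZMod.val_cast_of_lt (mem_range.1 hj)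
    · intro x _; simp
    · simp
  rw [← h2, ← Finset.sum_subset (s₁ := Icc 1 (p - 1)) (s₂ := range p)]
  · intro j hj; simp only [mem_range, mem_Icc] at *; omega
  · intro j hj hj'
    have : j = 0 := by simp only [mem_range, mem_Icc] at *; omega
    simp [this, hk0]

lemma PadicInt.prime_dvd_iff_toZMod_eq_zero (p : ℕ) [Fact p.Prime] (x : ℤ_[p]) :
    (p : ℤ_[p]) ∣ x ↔ PadicInt.toZMod x = 0 := by
  rw [← RingHom.mem_ker, PadicInt.ker_toZMod, PadicInt.maximalIdeal_eq_span_p,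
    Ideal.mem_span_singleton]

/-- Half of the symmetric power sums of `1 / (j (p - j))` vanish modulo `p = 2n + 1`. -/
lemma PadicInt.prime_dvd_sum_inv_mul_pow {p n : ℕ} [Fact p.Prime] (hn : p = 2 * n + 1)
    (k : ℕ) (hk0 : k ≠ 0) (hk : 2 * k < p - 1) (i : ℕ → ℤ_[p])
    (hi : ∀ j ∈ Icc 1 (2 * n), (j : ℤ_[p]) * i j = 1) :
    (p : ℤ_[p]) ∣ ∑ j ∈ Icc 1 n, (i j * i (2 * n + 1 - j)) ^ k := by
  rw [PadicInt.prime_dvd_iff_toZMod_eq_zero]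
  have hpc : ((2 * n + 1 : ℕ) : ZMod p) = 0 := by rw [← hn]; simp
  have hti : ∀ j ∈ Icc 1 (2 * n), PadicInt.toZMod (i j) = (j : ZMod p)⁻¹ := by
    intro j hj
    apply eq_inv_of_mul_eq_one_right
    simpa using congrArg PadicInt.toZMod (hi j hj)
  have hv : ∀ j ∈ Icc 1 (2 * n), PadicInt.toZMod ((i j * i (2 * n + 1 - j)) ^ k) =
      (-1) ^ k * (j : ZMod p)⁻¹ ^ (2 * k) := by
    intro j hj
    have hj' := mem_Icc.1 hj
    rw [map_pow, map_mul, hti j hj, hti (2 * n + 1 - j) (mem_Icc.2 (by omega)),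
      Nat.cast_sub (by omega), hpc, zero_sub, inv_neg, pow_mul, ← mul_pow]
    ring
  have hfull : PadicInt.toZMod (∑ j ∈ Icc 1 (2 * n), (i j * i (2 * n + 1 - j)) ^ k) = 0 := by
    rw [map_sum, sum_congr rfl hv, ← mul_sum, show 2 * n = p - 1 by omega,
      ZMod.sum_Icc_inv_pow_eq_zero p (2 * k) (by omega) hk, mul_zero]
  rw [sum_Icc_one_two_mul, sum_congr rfl (g := fun j => 2 * (i j * i (2 * n + 1 - j)) ^ k),
    ← mul_sum, map_mul] at hfull
  · refine (mul_eq_zero.1 hfull).resolve_left ?_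
    rw [map_ofNat]
    intro h
    have := (ZMod.natCast_eq_zero_iff 2 p).1 (by exact_mod_cast h)
    have := Nat.le_of_dvd (by norm_num) this
    omega
  · intro j hj
    have hj' := mem_Icc.1 hj
    rw [show 2 * n + 1 - (2 * n + 1 - j) = j by omega]
    ring

lemma PadicInt.exists_prod_one_sub_eq {p n : ℕ} [Fact p.Prime] (hn : p = 2 * n + 1)
    (hp7 : 7 ≤ p) (i : ℕ → ℤ_[p]) (hi : ∀ j ∈ Icc 1 (2 * n), (j : ℤ_[p]) * i j = 1) :
    ∃ z, ∏ j ∈ Icc 1 n, (1 - (p : ℤ_[p]) ^ 2 * (i 4 * (i j * i (2 * n + 1 - j)))) =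
      1 + i 4 * i 2 * p ^ 2 * ∑ j ∈ Icc 1 (2 * n), i j ^ 2 + p ^ 5 * z := by
  obtain ⟨a, ha⟩ := PadicInt.prime_dvd_sum_inv_mul_pow hn 1 (by omega) (by omega) i hi
  obtain ⟨b, hb⟩ := PadicInt.prime_dvd_sum_inv_mul_pow hn 2 (by omega) (by omega) i hi
  obtain ⟨r, hr⟩ := exists_two_mul_prod_one_add_mul (Icc 1 n)
    (fun j => -(i 4 * (i j * i (2 * n + 1 - j)))) ((p : ℤ_[p]) ^ 2)
  have h2 : (2 : ℤ_[p]) * i 2 = 1 := by exact_mod_cast hi 2 (mem_Icc.2 (by omega))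
  have hS : ∑ j ∈ Icc 1 (2 * n), i j ^ 2 =
      p ^ 2 * ∑ j ∈ Icc 1 n, (i j * i (2 * n + 1 - j)) ^ 2 -
        2 * ∑ j ∈ Icc 1 n, (i j * i (2 * n + 1 - j)) ^ 1 := by
    rw [sum_Icc_one_two_mul, mul_sum, mul_sum, ← sum_sub_distrib]
    refine sum_congr rfl fun j hj => ?_
    have hj' := mem_Icc.1 hj
    have e1 := hi j (mem_Icc.2 (by omega))
    have e2 := hi (2 * n + 1 - j) (mem_Icc.2 (by omega))
    rw [← hn, Nat.cast_sub (by omega)] at e2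
    rw [← hn]
    have e3 : i j + i (p - j) = p * (i j * i (p - j)) := by
      linear_combination -i (p - j) * e1 - i j * e2
    linear_combination (i j + i (p - j) + p * (i j * i (p - j))) * e3
  simp only [mul_neg, ← sub_eq_add_neg, sum_neg_distrib, neg_sq, mul_pow (i 4), ← mul_sum] at hr
  simp only [pow_one] at ha hS
  rw [ha, hb] at hr hS
  refine ⟨i 2 * (i 4 ^ 2 * (p * a ^ 2 - b) + p * r - i 4 * b), ?_⟩
  rw [hS]
  linear_combination i 2 * hr + (1 - ∏ j ∈ Icc 1 n,
    (1 - (p : ℤ_[p]) ^ 2 * (i 4 * (i j * i (2 * n + 1 - j))))) * h2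

lemma isPInteger_of_padic_eq {p : ℕ} [Fact p.Prime] {x : ℚ} (z : ℤ_[p])
    (h : (x : ℚ_[p]) = z) : IsPInteger p x := by
  rw [IsPInteger, ← Padic.valuation_ratCast, h]
  exact PadicInt.valuation_coe_nonneg

theorem central_binom_harmonic2_mod_p5 (p : ℕ) (hp : p.Prime) (hp7 : 7 ≤ p) :
    PModEq p 5
      ((-1 : ℚ) ^ ((p - 1) / 2) * (Nat.choose (p - 1) ((p - 1) / 2) : ℚ))
      ((4 : ℚ) ^ (p - 1) *
        (1 + (1 / 8) * p ^ 2 * (∑ k ∈ Finset.Icc 1 (p - 1), (1 : ℚ) / (k ^ 2)))) := by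
  have : Fact p.Prime := ⟨hp⟩
  obtain ⟨n, hn⟩ := hp.odd_of_ne_two (by omega)
  have hp0 : (p : ℚ_[p]) ≠ 0 := by exact_mod_cast hp.ne_zero
  have hex : ∀ j ∈ Icc 1 (2 * n), ∃ y : ℤ_[p], (j : ℤ_[p]) * y = 1 := by
    intro j hj
    rw [mem_Icc] at hj
    refine ((PadicInt.isUnit_iff).2 ?_).exists_right_inv
    rw [PadicInt.norm_natCast_eq_one_iff]
    exact (Nat.coprime_of_lt_prime (by omega) (by omega) hp)
  have hpc : (p : ℚ_[p]) = 2 * n + 1 := by exact_mod_cast congrArg (Nat.cast : ℕ → ℚ_[p]) hn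
  choose! i hi using hex
  obtain ⟨z, hz⟩ := PadicInt.exists_prod_one_sub_eq hn hp7 i hi
  have hic : ∀ j ∈ Icc 1 (2 * n), ((i j : ℤ_[p]) : ℚ_[p]) = (j : ℚ_[p])⁻¹ := by
    intro j hj
    apply eq_inv_of_mul_eq_one_right
    exact_mod_cast congrArg (fun x : ℤ_[p] => (x : ℚ_[p])) (hi j hj)
  rw [show (p - 1) / 2 = n by omega, show p - 1 = 2 * n by omega]
  apply isPInteger_of_padic_eq (((4 ^ (2 * n) : ℕ) : ℤ_[p]) * z)
  rw [neg_one_pow_mul_centralBinom, show (16 : ℚ) ^ n = 4 ^ (2 * n) by rw [pow_mul]; norm_num]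
  have hprod : ((∏ j ∈ Icc 1 n, (1 - (2 * n + 1) ^ 2 / (4 * (j * (2 * n + 1 - j))) : ℚ) : ℚ) :
      ℚ_[p]) = ((∏ j ∈ Icc 1 n,
        (1 - (p : ℤ_[p]) ^ 2 * (i 4 * (i j * i (2 * n + 1 - j)))) : ℤ_[p]) : ℚ_[p]) := by
    rw [Rat.cast_prod]
    refine Eq.trans ?_ (map_prod PadicInt.Coe.ringHom _ _).symm
    refine prod_congr rfl fun j hj => ?_
    have hj' := mem_Icc.1 hj
    change _ = ((1 - (p : ℤ_[p]) ^ 2 * (i 4 * (i j * i (2 * n + 1 - j))) : ℤ_[p]) : ℚ_[p])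
    push_cast
    rw [hic 4 (mem_Icc.2 (by omega)), hic j (mem_Icc.2 (by omega)),
      hic (2 * n + 1 - j) (mem_Icc.2 (by omega)), Nat.cast_sub (by omega), hpc]
    push_cast
    rw [div_eq_mul_inv, mul_inv, mul_inv]
  have hsum : ((∑ k ∈ Icc 1 (2 * n), (1 : ℚ) / (k ^ 2) : ℚ) : ℚ_[p]) =
      ((∑ j ∈ Icc 1 (2 * n), i j ^ 2 : ℤ_[p]) : ℚ_[p]) := by
    rw [Rat.cast_sum, PadicInt.coe_sum]
    refine sum_congr rfl fun j hj => ?_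
    push_cast
    rw [hic j hj, one_div, inv_pow]
  rw [Rat.cast_div, Rat.cast_sub, Rat.cast_mul, hprod, hz, div_eq_iff (by simpa using hp0),
    Rat.cast_mul, Rat.cast_add, Rat.cast_mul, hsum,
    PadicInt.coe_mul _ z, PadicInt.coe_natCast]
  push_cast
  rw [hic 4 (mem_Icc.2 (by omega)), hic 2 (mem_Icc.2 (by omega))]
  push_cast
  ring
end
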